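/- arXiv:2101.09328 — 5 statements merged into one kernel-verified Lean document; each statement's English description precedes it below -/
import Mathlib

section
/- Let α be a finite type (the set of card types) and n : α → ℕ an assignment of multiplicities, with N = ∑_{a ∈ α} n(a). Then for every k ∈ ℕ, the sum over all ordered tuples f : Fin k → α of the product ∏_{a ∈ α} (n(a))_{δ_f(a)} — where δ_f(a) is the number of indices i with f(i) = a and (m)_d = m(m−1)⋯(m−d+1) denotes the falling factorial — equals the falling factorial (N)_k. -/
/-- For a finite type `α` of card types with multiplicities `n : α → ℕ` and
`N = ∑ a, n a`, the sum over all ordered tuples `f : Fin k → α` of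
`∏ a, (n a)_{δ_f a}` (falling factorials, where `δ_f a` is the size of the fiber of `f`
at `a`) equals the falling factorial `(N)_k`. -/
theorem weighted_ordered_draws_eq_descFactorial
    (α : Type*) [Fintype α] [DecidableEq α] (n : α → ℕ) (k : ℕ) :
    ∑ f : Fin k → α,
        ∏ a : α, (n a).descFactorial (Finset.univ.filter (fun i => f i = a)).card
      = (∑ a : α, n a).descFactorial k := by
  induction k with
  | zero => simp
  | succ k ih =>
    rw [Nat.descFactorial_succ, ← ih, ← (Fin.consEquiv (fun _ => α)).sum_comp,
      Fintype.sum_prod_type, Finset.sum_comm, Finset.mul_sum]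
    refine Finset.sum_congr rfl fun f _ => ?_
    have hcard : ∀ b a : α,
        (Finset.univ.filter (fun i => (Fin.consEquiv (fun _ => α)) (b, f) i = a)).card
          = (Finset.univ.filter (fun i => f i = a)).card + if b = a then 1 else 0 := by
      intro b a
      rw [Finset.card_filter, Finset.card_filter, Fin.sum_univ_succ]
      simp [Fin.consEquiv, add_comm]
    have hprod : ∀ b : α,
        ∏ a : α, (n a).descFactorial
          (Finset.univ.filter (fun i => (Fin.consEquiv (fun _ => α)) (b, f) i = a)).card
        = (n b - (Finset.univ.filter (fun i => f i = b)).card) *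
          ∏ a : α, (n a).descFactorial (Finset.univ.filter (fun i => f i = a)).card := by
      intro b
      have h : ∀ a : α, (n a).descFactorial
          (Finset.univ.filter (fun i => (Fin.consEquiv (fun _ => α)) (b, f) i = a)).card
          = (if b = a then n a - (Finset.univ.filter (fun i => f i = a)).card else 1) *
            (n a).descFactorial (Finset.univ.filter (fun i => f i = a)).card := by
        intro a
        rw [hcard]
        split_ifs
        · rw [Nat.descFactorial_succ]
        · simp
      rw [Finset.prod_congr rfl fun a _ => h a, Finset.prod_mul_distrib, Finset.prod_ite_eq]
      simp
    rw [Finset.sum_congr rfl fun b _ => hprod b, ← Finset.sum_mul]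
    by_cases h0 : ∏ a : α, (n a).descFactorial (Finset.univ.filter (fun i => f i = a)).card = 0
    · rw [h0]; simp
    · congr 1
      have hle : ∀ a ∈ (Finset.univ : Finset α),
          (Finset.univ.filter (fun i => f i = a)).card ≤ n a := by
        intro a ha
        by_contra hlt
        exact h0 (Finset.prod_eq_zero ha (Nat.descFactorial_eq_zero_iff_lt.2 (not_le.1 hlt)))
      rw [Finset.sum_tsub_distrib _ hle]
      congr 1
      rw [← Finset.card_eq_sum_card_fiberwise (fun i _ => Finset.mem_coe.2 (Finset.mem_univ (f i)))]
      simp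
end

section
/- Let α be a finite type and n : α → ℕ with N = ∑_{a ∈ α} n(a). For every k ∈ ℕ, the sum over all functions δ : α → ℕ satisfying ∑_{a} δ(a) = k of the product of the multinomial coefficient k!/∏_{a} δ(a)! with ∏_{a ∈ α} (n(a))_{δ(a)} equals the falling factorial (N)_k, where (m)_d = m(m−1)⋯(m−d+1). -/
theorem choose_sum_aux (α : Type*) [Fintype α] [DecidableEq α] (n : α → ℕ) (k : ℕ) :
    ∑ δ ∈ (Fintype.piFinset fun _ : α => Finset.range (k + 1)).filter
        (fun δ => ∑ a : α, δ a = k), ∏ a : α, (n a).choose (δ a)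
      = (∑ a : α, n a).choose k := by
  have h := PowerSeries.coeff_prod (R := ℕ)
    (fun a : α => (((1 + Polynomial.X) ^ n a : Polynomial ℕ) : PowerSeries ℕ)) k Finset.univ
  have h2 : ∏ a : α, (((1 + Polynomial.X) ^ n a : Polynomial ℕ) : PowerSeries ℕ)
      = (((1 + Polynomial.X) ^ (∑ a, n a) : Polynomial ℕ) : PowerSeries ℕ) := by
    simp only [Polynomial.coe_pow, Finset.prod_pow_eq_pow_sum]
  rw [h2] at h
  simp only [Polynomial.coeff_coe, Polynomial.coeff_one_add_X_pow, Nat.cast_id] at h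
  rw [h]
  symm
  refine Finset.sum_bij (fun l _ => (l : α → ℕ)) ?_ ?_ ?_ ?_
  · intro l hl
    have hs : ∑ a, l a = k := by simpa [Finset.mem_finsuppAntidiag] using hl
    simp only [Finset.mem_filter, Fintype.mem_piFinset, Finset.mem_range]
    refine ⟨fun a => ?_, hs⟩
    have := Finset.single_le_sum (f := fun a => l a) (fun _ _ => Nat.zero_le _)
      (Finset.mem_univ a)
    simp only [hs] at this
    omega
  · intro a _ b _ hab
    exact DFunLike.coe_injective hab
  · intro δ hδ
    refine ⟨Finsupp.equivFunOnFinite.symm δ, ?_, rfl⟩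
    have := (Finset.mem_filter.1 hδ).2
    simpa [Finset.mem_finsuppAntidiag] using this
  · intro _ _
    rfl


/-- Multivariate Vandermonde identity for falling factorials: for a finite
type `α`, `n : α → ℕ`, `N = ∑ a, n a` and any `k`, the sum over all `δ : α → ℕ` with
`∑ a, δ a = k` of `(k! / ∏ a, (δ a)!) * ∏ a, (n a)_{δ a}` equals `(N)_k`. -/
theorem multinomial_descFactorial_sum
    (α : Type*) [Fintype α] [DecidableEq α] (n : α → ℕ) (k : ℕ) :
    ∑ δ ∈ (Fintype.piFinset fun _ : α => Finset.range (k + 1)).filter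
        (fun δ => ∑ a : α, δ a = k),
        Nat.multinomial Finset.univ δ * ∏ a : α, (n a).descFactorial (δ a)
      = (∑ a : α, n a).descFactorial k := by
  rw [Nat.descFactorial_eq_factorial_mul_choose, ← choose_sum_aux, Finset.mul_sum]
  refine Finset.sum_congr rfl fun δ hδ => ?_
  have hs := (Finset.mem_filter.1 hδ).2
  have hm := Nat.multinomial_spec Finset.univ δ
  rw [hs] at hm
  simp only [Nat.descFactorial_eq_factorial_mul_choose, Finset.prod_mul_distrib]
  rw [← hm]
  ring
end

section
/- Let α be a finite type and n : α → ℕ with N = ∑_{a ∈ α} n(a), and let k ∈ ℕ satisfy k ≤ N. Then, working in ℚ, the sum over all ordered tuples f : Fin k → α of the ratio (∏_{a ∈ α} (n(a))_{δ_f(a)}) / (N)_k equals 1, where δ_f(a) is the number of indices i with f(i) = a and (m)_d denotes the falling factorial m(m−1)⋯(m−d+1). -/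
lemma cast_descFactorial_step (m d : ℕ) :
    ((m.descFactorial (d + 1) : ℕ) : ℚ) = ((m : ℚ) - d) * (m.descFactorial d : ℚ) := by
  rw [Nat.descFactorial_succ]
  rcases le_or_gt d m with h | h
  · push_cast [Nat.cast_sub h]
    ring
  · rw [Nat.descFactorial_eq_zero_iff_lt.2 h]
    simp

lemma hand_sum_eq {α : Type*} [Fintype α] [DecidableEq α] (n : α → ℕ) (k : ℕ) :
    ∑ f : Fin k → α,
        (∏ a : α, ((n a).descFactorial (Finset.univ.filter (fun i => f i = a)).card : ℚ))
      = ((∑ a : α, n a).descFactorial k : ℚ) := by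
  induction k with
  | zero => simp
  | succ k ih =>
    rw [cast_descFactorial_step, ← ih, Finset.mul_sum,
      ← (Fin.consEquiv (fun _ : Fin (k + 1) => α)).sum_comp, Fintype.sum_prod_type_right]
    refine Finset.sum_congr rfl fun f _ => ?_
    have hcard : ∑ a : α, ((Finset.univ.filter (fun i => f i = a)).card : ℚ) = k := by
      have h := Finset.card_eq_sum_card_fiberwise (f := f) (s := Finset.univ)
        (t := Finset.univ) (by intro x _; simp)
      rw [Finset.card_univ, Fintype.card_fin] at h
      exact_mod_cast h.symm
    have key : ∀ a : α,
        (∏ b : α, ((n b).descFactorial (Finset.univ.filter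
          (fun i => (Fin.consEquiv (fun _ : Fin (k + 1) => α)) (a, f) i = b)).card : ℚ))
        = ((n a : ℚ) - ((Finset.univ.filter (fun i => f i = a)).card : ℚ)) *
          ∏ b : α, ((n b).descFactorial (Finset.univ.filter (fun i => f i = b)).card : ℚ) := by
      intro a
      rw [← Finset.mul_prod_erase _ _ (Finset.mem_univ a),
        ← Finset.mul_prod_erase _ (fun b => ((n b).descFactorial
          (Finset.univ.filter (fun i => f i = b)).card : ℚ)) (Finset.mem_univ a), ← mul_assoc]
      congr 1
      · rw [← cast_descFactorial_step, Fin.card_filter_univ_succ]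
        simp [Fin.consEquiv]
      · refine Finset.prod_congr rfl fun b hb => ?_
        have hne : a ≠ b := (Finset.ne_of_mem_erase hb).symm
        rw [Fin.card_filter_univ_succ]
        simp [Fin.consEquiv, hne]
    rw [Finset.sum_congr rfl fun a _ => key a, ← Finset.sum_mul, Finset.sum_sub_distrib, hcard]
    push_cast
    rfl

/-- Single-hint-class case of the paper's Theorem A.1: for a finite type `α`
with multiplicities `n : α → ℕ`, `N = ∑ a, n a` and `k ≤ N`, the probabilities of ordered
hands drawn without replacement sum to 1 in `ℚ`:
`∑_{f : Fin k → α} (∏ a, (n a)_{δ_f a}) / (N)_k = 1`. -/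
theorem ordered_hand_prob_sum_eq_one
    (α : Type*) [Fintype α] [DecidableEq α] (n : α → ℕ) (k : ℕ)
    (hk : k ≤ ∑ a : α, n a) :
    ∑ f : Fin k → α,
        (∏ a : α, ((n a).descFactorial (Finset.univ.filter (fun i => f i = a)).card : ℚ))
          / ((∑ a : α, n a).descFactorial k : ℚ)
      = 1 := by
  rw [← Finset.sum_div, hand_sum_eq]
  refine div_self ?_
  rw [Nat.cast_ne_zero, Ne, Nat.descFactorial_eq_zero_iff_lt]
  exact not_lt.2 hk
end

section
/- Let H be a finite type (the set of distinct hints received), and for each h ∈ H let α_h be a finite type (the card types consistent with hint h), n_h : α_h → ℕ a multiplicity assignment with N_h = ∑_{a} n_h(a), and λ(h) ∈ ℕ a number of hand positions carrying hint h, with λ(h) ≤ N_h for every h. Then, working in ℚ, the sum over all families of ordered tuples (f_h : Fin (λ(h)) → α_h)_{h ∈ H} of the product ∏_{h ∈ H} [(∏_{a ∈ α_h} (n_h(a))_{δ_{f_h}(a)}) / (N_h)_{λ(h)}] equals 1, where δ_{f_h}(a) is the number of indices i with f_h(i) = a and (m)_d denotes the falling factorial m(m−1)⋯(m−d+1). 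-/
lemma hanabi_aux {α : Type*} [Fintype α] [DecidableEq α] (n : α → ℕ) (k : ℕ) :
    ∑ f : Fin k → α, ∏ a : α, (n a).descFactorial (Finset.univ.filter (fun i => f i = a)).card
      = (∑ a, n a).descFactorial k := by
  induction k with
  | zero => simp
  | succ k ih =>
    rw [← (Fin.consEquiv (fun _ : Fin (k+1) => α)).sum_comp, Fintype.sum_prod_type,
      Finset.sum_comm, Nat.descFactorial_succ, ← ih, Finset.mul_sum]
    refine Finset.sum_congr rfl fun g _ => ?_
    have hcard : ∀ b a : α, (Finset.univ.filter
        (fun i => (Fin.consEquiv (fun _ : Fin (k+1) => α)) (b, g) i = a)).card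
        = (Finset.univ.filter (fun i => g i = a)).card + (if b = a then 1 else 0) := by
      intro b a
      rw [Finset.card_filter, Finset.card_filter, Fin.sum_univ_succ, add_comm]
      rfl
    have hprod : ∀ b : α, ∏ a : α, (n a).descFactorial ((Finset.univ.filter
        (fun i => (Fin.consEquiv (fun _ : Fin (k+1) => α)) (b, g) i = a)).card)
        = (n b - (Finset.univ.filter (fun i => g i = b)).card) *
          ∏ a : α, (n a).descFactorial (Finset.univ.filter (fun i => g i = a)).card := by
      intro b
      have h1 : (n b - (Finset.univ.filter (fun i => g i = b)).card)
          = ∏ a : α, if b = a then (n a - (Finset.univ.filter (fun i => g i = a)).card) else 1 := by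
        simp
      rw [h1, ← Finset.prod_mul_distrib]
      refine Finset.prod_congr rfl fun a _ => ?_
      rw [hcard]
      split_ifs
      · rw [Nat.descFactorial_succ]
      · simp
    rw [Finset.sum_congr rfl fun b _ => hprod b, ← Finset.sum_mul]
    by_cases h0 : ∏ a : α, (n a).descFactorial (Finset.univ.filter (fun i => g i = a)).card = 0
    · rw [h0]; simp
    · congr 1
      have hle : ∀ a : α, (Finset.univ.filter (fun i => g i = a)).card ≤ n a := by
        intro a
        have := (Finset.prod_ne_zero_iff.mp h0) a (Finset.mem_univ a)
        rw [Ne, Nat.descFactorial_eq_zero_iff_lt] at this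
        omega
      rw [Finset.sum_tsub_distrib _ (fun a _ => hle a)]
      congr 1
      have := Finset.card_eq_sum_card_fiberwise (f := g) (s := Finset.univ) (t := Finset.univ)
        (fun _ _ => by simp)
      simpa using this.symm


/-- Paper's Theorem A.1: with a finite type `H` of distinct hints, for each
hint `h` a finite type `α h` of consistent card types with multiplicities `n h : α h → ℕ`
(total `N h = ∑ a, n h a`) and a number `lam h` of hand positions carrying hint `h` with
`lam h ≤ N h`, the hand probabilities sum to 1 in `ℚ`:
`∑_{(f_h)_h} ∏ h, (∏ a, (n h a)_{δ_{f_h} a}) / (N h)_{lam h} = 1`. -/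
theorem hanabi_hand_prob_sum_eq_one
    (H : Type*) [Fintype H] [DecidableEq H] (α : H → Type*) [∀ h, Fintype (α h)] [∀ h, DecidableEq (α h)]
    (n : (h : H) → α h → ℕ) (lam : H → ℕ)
    (hlam : ∀ h : H, lam h ≤ ∑ a : α h, n h a) :
    ∑ f : (h : H) → Fin (lam h) → α h,
        ∏ h : H,
          (∏ a : α h,
              ((n h a).descFactorial (Finset.univ.filter (fun i => f h i = a)).card : ℚ))
            / ((∑ a : α h, n h a).descFactorial (lam h) : ℚ)
      = 1 := by
  have key := Finset.prod_univ_sum (fun h : H => (Finset.univ : Finset (Fin (lam h) → α h)))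
    (fun h f => (∏ a : α h,
      ((n h a).descFactorial (Finset.univ.filter (fun i => f i = a)).card : ℚ))
            / ((∑ a : α h, n h a).descFactorial (lam h) : ℚ))
  rw [Fintype.piFinset_univ] at key
  rw [← key]
  refine Finset.prod_eq_one fun h _ => ?_
  rw [← Finset.sum_div]
  have h2 := congrArg (Nat.cast : ℕ → ℚ) (hanabi_aux (n h) (lam h))
  rw [Nat.cast_sum] at h2
  simp only [Nat.cast_prod] at h2
  rw [h2]
  refine div_self ?_
  rw [Nat.cast_ne_zero, Ne, Nat.descFactorial_eq_zero_iff_lt]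
  exact not_lt.mpr (hlam h)
end

section
/- Let α be a finite type, n : α → ℕ, N = ∑_{a ∈ α} n(a), and k ≤ N. Then, working in ℚ, the sum over all functions δ : α → ℕ with ∑_a δ(a) = k and δ(a) ≤ n(a) for all a, of the quantity (k!/∏_a δ(a)!) · (∏_a (n(a))_{δ(a)}) / (N)_k equals 1; moreover each summand is nonnegative. Hence δ ↦ (k!/∏_a δ(a)!) · (∏_a (n(a))_{δ(a)}) / (N)_k defines a probability mass function on the set of such multiplicity vectors δ (the multivariate hypergeometric distribution). -/
theorem vandermonde_aux {α : Type*} [Fintype α] [DecidableEq α] (n : α → ℕ) (k : ℕ) :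
    ∑ δ ∈ (Fintype.piFinset fun _ : α => Finset.range (k + 1)).filter
          (fun δ => (∑ a : α, δ a = k) ∧ ∀ a : α, δ a ≤ n a),
        ∏ a : α, ((n a).choose (δ a)) = (∑ a : α, n a).choose k := by
  have h1 : (PowerSeries.coeff k) (∏ a : α, (((1 + Polynomial.X : Polynomial ℕ) ^ (n a) : Polynomial ℕ) : PowerSeries ℕ))
      = (∑ a : α, n a).choose k := by
    have : (∏ a : α, (((1 + Polynomial.X : Polynomial ℕ) ^ (n a) : Polynomial ℕ) : PowerSeries ℕ))
        = (((1 + Polynomial.X : Polynomial ℕ) ^ (∑ a, n a) : Polynomial ℕ) : PowerSeries ℕ) := by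
      simp only [Polynomial.coe_pow, Finset.prod_pow_eq_pow_sum]
    rw [this, Polynomial.coeff_coe, Polynomial.coeff_one_add_X_pow]
    simp
  rw [← h1, PowerSeries.coeff_prod]
  simp only [Polynomial.coeff_coe, Polynomial.coeff_one_add_X_pow, Nat.cast_id]
  symm
  rw [← Finset.sum_filter_of_ne (p := fun l : α →₀ ℕ => ∀ a, l a ≤ n a)]
  · refine Finset.sum_nbij' (fun l => (l : α → ℕ)) (fun f => Finsupp.equivFunOnFinite.symm f) ?_ ?_ ?_ ?_ ?_
    · intro l hl
      simp only [Finset.mem_filter, Finset.mem_finsuppAntidiag, Fintype.mem_piFinset, Finset.mem_range] at hl ⊢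
      refine ⟨fun a => ?_, hl.1.1, hl.2⟩
      have := Finset.single_le_sum (f := fun a => l a) (fun i _ => Nat.zero_le _) (Finset.mem_univ a)
      have h2 := hl.1.1
      exact Nat.lt_succ_of_le (this.trans h2.le)
    · intro f hf
      simp only [Finset.mem_filter] at hf
      simp [Finset.mem_finsuppAntidiag, hf.2.1, hf.2.2]
    · intro l _
      ext; simp
    · intro f _
      ext; simp
    · intro l _
      rfl
  · intro l _ h a
    by_contra hc
    exact h (Finset.prod_eq_zero (Finset.mem_univ a) (Nat.choose_eq_zero_of_lt (by omega)))

/-- The multivariate hypergeometric distribution is a probability mass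
function: for a finite type `α`, `n : α → ℕ`, `N = ∑ a, n a` and `k ≤ N`, the quantities
`(k!/∏ a, (δ a)!) * (∏ a, (n a)_{δ a}) / (N)_k`, summed over all `δ : α → ℕ` with
`∑ a, δ a = k` and `δ a ≤ n a` for all `a`, equal 1, and each summand is nonnegative. -/
theorem multivariate_hypergeometric_pmf
    (α : Type*) [Fintype α] [DecidableEq α] (n : α → ℕ) (k : ℕ)
    (hk : k ≤ ∑ a : α, n a) :
    (∑ δ ∈ (Fintype.piFinset fun _ : α => Finset.range (k + 1)).filter
          (fun δ => (∑ a : α, δ a = k) ∧ ∀ a : α, δ a ≤ n a),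
        (Nat.multinomial Finset.univ δ : ℚ) * (∏ a : α, ((n a).descFactorial (δ a) : ℚ))
          / ((∑ a : α, n a).descFactorial k : ℚ)
      = 1)
    ∧ ∀ δ : α → ℕ, (∑ a : α, δ a = k) → (∀ a : α, δ a ≤ n a) →
        0 ≤ (Nat.multinomial Finset.univ δ : ℚ)
              * (∏ a : α, ((n a).descFactorial (δ a) : ℚ))
              / ((∑ a : α, n a).descFactorial k : ℚ) := by
  refine ⟨?_, fun δ _ _ => by positivity⟩
  rw [← Finset.sum_div, div_eq_one_iff_eq]
  · rw [Nat.descFactorial_eq_factorial_mul_choose, ← vandermonde_aux]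
    push_cast
    rw [Finset.mul_sum]
    refine Finset.sum_congr rfl fun δ hδ => ?_
    have hs : ∑ a, δ a = k := (Finset.mem_filter.mp hδ).2.1
    have hm := Nat.multinomial_spec Finset.univ δ
    rw [hs] at hm
    rw [← hm]
    simp only [Nat.descFactorial_eq_factorial_mul_choose]
    push_cast
    rw [Finset.prod_mul_distrib]
    ring
  · have := Nat.descFactorial_pos.mpr hk
    positivity
end
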